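/- Let μ be a probability measure and τ ≥ 0 measurable with μ{τ > t} ≤ c·t^{-β} for all t > 0, where c > 0, β > 1. Let γ > 0 and q ≥ 1 satisfy β - qγ ∈ (0,1). Then there exists C > 0 such that for all u ∈ (0,1), ∫ τ^{qγ+1} e^{-uτ} dμ ≤ C·u^{β-qγ-1}. -/

import Mathlib

open MeasureTheory Filter

/-- Bounding `exp (-(u * t))` below by its value at the right end of `[0, s]`. -/
lemma rpow_mul_exp_le_intervalIntegral {p u s : ℝ} (hp : 1 ≤ p) (hu : 0 ≤ u) (hs : 0 ≤ s) :
    s ^ p * Real.exp (-(u * s)) ≤ ∫ t in 0..s, p * t ^ (p - 1) * Real.exp (-(u * t)) := by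
  have hcont : Continuous fun t : ℝ => t ^ (p - 1) :=
    Real.continuous_rpow_const (by linarith)
  calc s ^ p * Real.exp (-(u * s)) = ∫ t in 0..s, p * t ^ (p - 1) * Real.exp (-(u * s)) := by
        rw [intervalIntegral.integral_mul_const, intervalIntegral.integral_const_mul,
          integral_rpow (Or.inl (by linarith)), sub_add_cancel, Real.zero_rpow (by linarith)]
        field_simp
        simp
    _ ≤ _ := by
        refine intervalIntegral.integral_mono_on hs
          (Continuous.intervalIntegrable (by fun_prop) _ _)
          (Continuous.intervalIntegrable (by fun_prop) _ _) fun t ht => ?_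
        have := Real.rpow_nonneg ht.1 (p - 1)
        have := ht.2
        gcongr

/-- A polynomial tail bound of order `β < p` controls the exponentially weighted `p`-th moment. -/
lemma lintegral_rpow_mul_exp_le_of_tail {X : Type*} [MeasurableSpace X] {μ : Measure X}
    {τ : X → ℝ} (hτm : Measurable τ) (hτ0 : ∀ x, 0 ≤ τ x) {c β p u : ℝ} (hc : 0 ≤ c)
    (hp : 1 ≤ p) (hβp : β < p) (hu : 0 < u)
    (htail : ∀ t : ℝ, 0 < t → μ {x | t < τ x} ≤ ENNReal.ofReal (c * t ^ (-β))) :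
    ∫⁻ x, ENNReal.ofReal (τ x ^ p * Real.exp (-(u * τ x))) ∂μ ≤
      ENNReal.ofReal (c * p * Real.Gamma (p - β) * u ^ (β - p)) := by
  have hcont : Continuous fun t : ℝ => t ^ (p - 1) :=
    Real.continuous_rpow_const (by linarith)
  have hpβ : 0 < p - β := sub_pos.2 hβp
  have hGamma := Real.integral_rpow_mul_exp_neg_mul_Ioi hpβ hu
  have hGpos := Real.Gamma_pos_of_pos hpβ
  have hint : IntegrableOn (fun t : ℝ => t ^ (p - β - 1) * Real.exp (-(u * t))) (Set.Ioi 0) :=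
    not_imp_comm.1 integral_undef (by rw [hGamma]; positivity)
  calc ∫⁻ x, ENNReal.ofReal (τ x ^ p * Real.exp (-(u * τ x))) ∂μ
      ≤ ∫⁻ x, ENNReal.ofReal (∫ t in 0..τ x, p * t ^ (p - 1) * Real.exp (-(u * t))) ∂μ :=
        lintegral_mono fun x => ENNReal.ofReal_le_ofReal
          (rpow_mul_exp_le_intervalIntegral hp hu.le (hτ0 x))
    _ = ∫⁻ t in Set.Ioi 0,
          μ {x | t < τ x} * ENNReal.ofReal (p * t ^ (p - 1) * Real.exp (-(u * t))) := by
        refine lintegral_comp_eq_lintegral_meas_lt_mul μ (ae_of_all _ hτ0) hτm.aemeasurable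
          (fun t _ => Continuous.intervalIntegrable (by fun_prop) _ _) ?_
        filter_upwards [ae_restrict_mem measurableSet_Ioi] with t ht
        have := Real.rpow_nonneg (Set.mem_Ioi.1 ht).le (p - 1)
        positivity
    _ ≤ ∫⁻ t in Set.Ioi 0,
          ENNReal.ofReal (c * p * (t ^ (p - β - 1) * Real.exp (-(u * t)))) := by
        refine setLIntegral_mono' measurableSet_Ioi fun t ht => ?_
        have ht : 0 < t := ht
        grw [htail t ht]
        rw [← ENNReal.ofReal_mul (by positivity),
          show p - β - 1 = -β + (p - 1) by ring, Real.rpow_add ht]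
        exact le_of_eq (by ring_nf)
    _ = ENNReal.ofReal (c * p * Real.Gamma (p - β) * u ^ (β - p)) := by
        rw [← ofReal_integral_eq_lintegral_ofReal (hint.const_mul _), integral_const_mul, hGamma,
          one_div, Real.inv_rpow hu.le, ← Real.rpow_neg hu.le, neg_sub]
        · ring_nf
        · filter_upwards [ae_restrict_mem measurableSet_Ioi] with t ht
          have ht : 0 < t := ht
          have : 0 ≤ p := by linarith
          simp only [Pi.zero_apply]
          positivity

theorem laplace_upper_bound {X : Type*} [MeasurableSpace X]
    (μ : Measure X) [IsProbabilityMeasure μ]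
    (τ : X → ℝ) (hτm : Measurable τ) (hτ0 : ∀ x, 0 ≤ τ x)
    (c β γ q : ℝ) (hc : 0 < c) (hβ : 1 < β) (hγ : 0 < γ) (hq : 1 ≤ q)
    (h1 : 0 < β - q * γ) (h2 : β - q * γ < 1)
    (htail : ∀ t : ℝ, 0 < t → μ {x | t < τ x} ≤ ENNReal.ofReal (c * t ^ (-β))) :
    ∃ C : ℝ, 0 < C ∧ ∀ u ∈ Set.Ioo (0:ℝ) 1,
      ∫ x, τ x ^ (q * γ + 1) * Real.exp (-(u * τ x)) ∂μ ≤ C * u ^ (β - q * γ - 1) := by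
  have hqγ : 0 < q * γ := by positivity
  have hG : 0 < Real.Gamma (q * γ + 1 - β) := Real.Gamma_pos_of_pos (by linarith)
  refine ⟨c * (q * γ + 1) * Real.Gamma (q * γ + 1 - β), by positivity, fun u hu => ?_⟩
  have hu0 : 0 < u := hu.1
  rw [sub_sub, integral_eq_lintegral_of_nonneg_ae
    (ae_of_all _ fun x => mul_nonneg (Real.rpow_nonneg (hτ0 x) _) (Real.exp_pos _).le)
    (by fun_prop)]
  exact ENNReal.toReal_le_of_le_ofReal (by positivity)
    (lintegral_rpow_mul_exp_le_of_tail hτm hτ0 hc.le (by linarith) (by linarith) hu0 htail)
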